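/- Let 0 < p < 1 be a probability. There exists a constant c > 0 depending only on p such that for all positive integers n and m with 1/(1-p)^{(1-p)n} ≤ m ≤ 1/(1-p)^{n}, setting α = -(log m)/(n·log(1-p)), the expected number of minimal edges satisfies E[|min(B_{n,m,p})|] ≥ c · 2^{(Hb(α) + (1-α)·log₂ p)·n} / √n. -/

import Mathlib

open MeasureTheory

/-- The Bernoulli(p) measure on `Bool`. -/
noncomputable def bernoulliBool (p : ℝ) : Measure Bool :=
  ENNReal.ofReal p • Measure.dirac true + ENNReal.ofReal (1 - p) • Measure.dirac false

instance (p : ℝ) : IsFiniteMeasure (bernoulliBool p) := by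
  constructor
  rw [bernoulliBool]
  simp [ENNReal.add_lt_top]

/-- The law of `m` i.i.d. random subsets of `{1,…,n}` (encoded as indicator vectors),
each element included independently with probability `p`. -/
noncomputable def hyperMeasure (n m : ℕ) (p : ℝ) : Measure (Fin m → Fin n → Bool) :=
  Measure.pi fun _ : Fin m => Measure.pi fun _ : Fin n => bernoulliBool p

/-- The subset of `Fin n` encoded by an indicator vector. -/
def toSet {n : ℕ} (f : Fin n → Bool) : Finset (Fin n) :=
  Finset.univ.filter fun i => f i = true

/-- The number of distinct minimal edges of the sampled multi-hypergraph:
sets `S` that occur among the samples and such that no sample is a proper subset of `S`. -/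
def minCount (n m : ℕ) (ω : Fin m → Fin n → Bool) : ℕ :=
  (Finset.univ.filter fun S : Finset (Fin n) =>
    (∃ j, toSet (ω j) = S) ∧ ∀ k, ¬ toSet (ω k) ⊂ S).card

/-- Expected size of the minimization of `B_{n,m,p}`. -/
noncomputable def expMin (n m : ℕ) (p : ℝ) : ℝ :=
  ∫ ω, (minCount n m ω : ℝ) ∂(hyperMeasure n m p)

/-- The binary entropy function. -/
noncomputable def binEnt (x : ℝ) : ℝ :=
  -(x * Real.logb 2 x) - (1 - x) * Real.logb 2 (1 - x)

lemma bernoulliBool_isProbabilityMeasure {p : ℝ} (hp0 : 0 ≤ p) (hp1 : p ≤ 1) :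
    IsProbabilityMeasure (bernoulliBool p) := by
  constructor
  simp [bernoulliBool, ← ENNReal.ofReal_add hp0 (sub_nonneg.2 hp1)]

lemma bernoulliBool_real_true {p : ℝ} (hp0 : 0 ≤ p) :
    (bernoulliBool p).real {true} = p := by
  simp [bernoulliBool, measureReal_def, hp0]

lemma bernoulliBool_real_false {p : ℝ} (hp1 : p ≤ 1) :
    (bernoulliBool p).real {false} = 1 - p := by
  simp [bernoulliBool, measureReal_def, hp1]

lemma mem_toSet {n : ℕ} {f : Fin n → Bool} {i : Fin n} : i ∈ toSet f ↔ f i = true := by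
  simp [toSet]

/-- The law of a single edge. -/
noncomputable def edgeMeasure (n : ℕ) (p : ℝ) : Measure (Fin n → Bool) :=
  Measure.pi fun _ : Fin n => bernoulliBool p

lemma edgeMeasure_isProbabilityMeasure (n : ℕ) {p : ℝ} (hp0 : 0 ≤ p) (hp1 : p ≤ 1) :
    IsProbabilityMeasure (edgeMeasure n p) := by
  have := bernoulliBool_isProbabilityMeasure hp0 hp1
  unfold edgeMeasure
  infer_instance

lemma edgeMeasure_real_pi (n : ℕ) (p : ℝ) (s : Fin n → Set Bool) :
    (edgeMeasure n p).real (Set.univ.pi s) = ∏ i, (bernoulliBool p).real (s i) := by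
  simp [edgeMeasure, measureReal_def, Measure.pi_pi, ENNReal.toReal_prod]

lemma edgeMeasure_real_eq {n : ℕ} {p : ℝ} (hp0 : 0 ≤ p) (hp1 : p ≤ 1) (S : Finset (Fin n)) :
    (edgeMeasure n p).real {f | toSet f = S} = p ^ S.card * (1 - p) ^ (n - S.card) := by
  have h : {f : Fin n → Bool | toSet f = S} =
      Set.univ.pi fun i => if i ∈ S then {true} else {false} := by
    ext f
    simp only [Set.mem_ofPred_eq, Finset.ext_iff, mem_toSet, Set.mem_pi, Set.mem_univ, true_imp_iff]
    refine forall_congr' fun i => ?_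
    by_cases hi : i ∈ S <;> simp [hi]
  rw [h, edgeMeasure_real_pi]
  have h2 : ∀ i, (bernoulliBool p).real (if i ∈ S then {true} else {false}) =
      if i ∈ S then p else 1 - p := fun i => by
    split_ifs
    exacts [bernoulliBool_real_true hp0, bernoulliBool_real_false hp1]
  simp_rw [h2]
  rw [Finset.prod_ite]
  simp [Finset.filter_not, ← Finset.compl_eq_univ_sdiff, Finset.card_compl]

lemma edgeMeasure_real_subset {n : ℕ} {p : ℝ} (hp0 : 0 ≤ p) (hp1 : p ≤ 1)
    (S : Finset (Fin n)) :
    (edgeMeasure n p).real {f | toSet f ⊆ S} = (1 - p) ^ (n - S.card) := by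
  have := bernoulliBool_isProbabilityMeasure hp0 hp1
  have h : {f : Fin n → Bool | toSet f ⊆ S} =
      Set.univ.pi fun i => if i ∈ S then Set.univ else {false} := by
    ext f
    simp only [Set.mem_ofPred_eq, Finset.subset_iff, mem_toSet, Set.mem_pi, Set.mem_univ,
      true_imp_iff]
    refine forall_congr' fun i => ?_
    by_cases hi : i ∈ S <;> simp [hi]
  rw [h, edgeMeasure_real_pi]
  have h2 : ∀ i, (bernoulliBool p).real (if i ∈ S then Set.univ else {false}) =
      if i ∈ S then 1 else 1 - p := fun i => by
    split_ifs
    exacts [probReal_univ, bernoulliBool_real_false hp1]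
  simp_rw [h2]
  rw [Finset.prod_ite]
  simp [Finset.filter_not, ← Finset.compl_eq_univ_sdiff, Finset.card_compl]

/-- The `j`-th sample is `S`, and no other sample is contained in `S`. -/
def soleEdgeBelow {n m : ℕ} (S : Finset (Fin n)) (j : Fin m) : Set (Fin m → Fin n → Bool) :=
  Set.univ.pi fun i => if i = j then {f | toSet f = S} else {f | toSet f ⊆ S}ᶜ

lemma hyperMeasure_real_soleEdgeBelow {n m : ℕ} {p : ℝ} (hp0 : 0 ≤ p) (hp1 : p ≤ 1)
    (S : Finset (Fin n)) (j : Fin m) :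
    (hyperMeasure n m p).real (soleEdgeBelow S j) =
      p ^ S.card * (1 - p) ^ (n - S.card) * (1 - (1 - p) ^ (n - S.card)) ^ (m - 1) := by
  have := edgeMeasure_isProbabilityMeasure n hp0 hp1
  change (Measure.pi fun _ : Fin m => edgeMeasure n p).real _ = _
  rw [measureReal_def, soleEdgeBelow, Measure.pi_pi, ENNReal.toReal_prod,
    ← Finset.mul_prod_erase _ _ (Finset.mem_univ j)]
  simp only [if_true, ← measureReal_def, edgeMeasure_real_eq hp0 hp1]
  congr 1
  rw [Finset.prod_congr rfl (g := fun _ => 1 - (1 - p) ^ (n - S.card)), Finset.prod_const]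
  · simp
  · intro i hi
    rw [if_neg (Finset.ne_of_mem_erase hi), probReal_compl_eq_one_sub (Set.toFinite _).measurableSet,
      edgeMeasure_real_subset hp0 hp1]

lemma sum_indicator_soleEdgeBelow_le {n m : ℕ} (𝒮 : Finset (Finset (Fin n)))
    (ω : Fin m → Fin n → Bool) :
    ∑ S ∈ 𝒮, ∑ j : Fin m, (soleEdgeBelow S j).indicator (fun _ => (1 : ℝ)) ω ≤ minCount n m ω := by
  classical
  rw [minCount, Finset.card_filter, Nat.cast_sum]
  refine (Finset.sum_le_sum fun S _ => ?_).trans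
    (Finset.sum_le_sum_of_subset_of_nonneg (Finset.subset_univ 𝒮) fun _ _ _ => by positivity)
  by_cases h : ∃ j, ω ∈ soleEdgeBelow S j
  · obtain ⟨j, hj⟩ := h
    have hj' : ∀ i, ω i ∈ if i = j then {f | toSet f = S} else {f | toSet f ⊆ S}ᶜ :=
      fun i => hj i (Set.mem_univ i)
    have hjS : toSet (ω j) = S := by simpa using hj' j
    have hne : ∀ i, i ≠ j → ¬ toSet (ω i) ⊆ S := fun i hi => by simpa [hi] using hj' i
    rw [if_pos, Finset.sum_eq_single j, Set.indicator_of_mem hj, Nat.cast_one]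
    · intro i _ hi
      refine Set.indicator_of_notMem (fun hmem => hne i hi ?_) _
      have : toSet (ω i) = S := by simpa using hmem i (Set.mem_univ i)
      exact this.subset
    · simp
    · refine ⟨⟨j, hjS⟩, fun k hk => ?_⟩
      by_cases hkj : k = j
      · subst hkj
        exact hk.ne hjS
      · exact hne k hkj hk.subset
  · push Not at h
    rw [Finset.sum_eq_zero fun j _ => Set.indicator_of_notMem (h j) _]
    positivity

lemma le_expMin {n m : ℕ} {p : ℝ} (hp0 : 0 ≤ p) (hp1 : p ≤ 1) {k : ℕ} :
    n.choose k * (m * (p ^ k * (1 - p) ^ (n - k) * (1 - (1 - p) ^ (n - k)) ^ (m - 1))) ≤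
      expMin n m p := by
  have : IsFiniteMeasure (hyperMeasure n m p) := by unfold hyperMeasure; infer_instance
  calc _ = ∑ S ∈ Finset.univ.powersetCard k, ∑ j : Fin m,
        (hyperMeasure n m p).real (soleEdgeBelow S j) := by
        rw [Finset.sum_congr rfl (g := fun _ =>
          m * (p ^ k * (1 - p) ^ (n - k) * (1 - (1 - p) ^ (n - k)) ^ (m - 1)))]
        · simp
        · intro S hS
          simp [hyperMeasure_real_soleEdgeBelow hp0 hp1, (Finset.mem_powersetCard.1 hS).2]
    _ = ∫ ω, ∑ S ∈ Finset.univ.powersetCard k, ∑ j : Fin m,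
        (soleEdgeBelow S j).indicator (fun _ => (1 : ℝ)) ω ∂(hyperMeasure n m p) := by
        rw [integral_finsetSum _ fun _ _ => .of_finite]
        refine Finset.sum_congr rfl fun S _ => ?_
        rw [integral_finsetSum _ fun _ _ => .of_finite]
        refine Finset.sum_congr rfl fun j _ => ?_
        rw [integral_indicator_const _ (Set.toFinite _).measurableSet]
        simp
    _ ≤ expMin n m p :=
        integral_mono .of_finite .of_finite fun ω => sum_indicator_soleEdgeBelow_le _ ω

lemma log_factorial_le {n : ℕ} (hn : n ≠ 0) :
    Real.log n.factorial ≤ 1 + Real.log n / 2 + n * Real.log n - n := by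
  obtain ⟨k, rfl⟩ := Nat.exists_eq_succ_of_ne_zero hn
  have h := Stirling.log_stirlingSeq'_antitone (Nat.zero_le k)
  simp only [Function.comp_apply, Nat.succ_eq_add_one, zero_add,
    Stirling.log_stirlingSeq_formula] at h
  have hk : (0 : ℝ) < (k + 1 : ℕ) := by positivity
  rw [Real.log_mul two_ne_zero hk.ne', Real.log_div hk.ne' (Real.exp_pos 1).ne', Real.log_exp] at h
  norm_num at h
  push_cast
  linarith

lemma le_log_choose_add (k l : ℕ) (h : k + l ≠ 0) :
    ((k + l : ℕ) : ℝ) * Real.log (k + l : ℕ) - k * Real.log k - l * Real.log l ≤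
      Real.log ((k + l).choose k) + 2 + Real.log (k + l : ℕ) / 2 := by
  have hlog : 0 ≤ Real.log (k + l : ℕ) := Real.log_natCast_nonneg _
  rcases Nat.eq_zero_or_pos k with rfl | hk
  · simp at hlog ⊢
    linarith
  rcases Nat.eq_zero_or_pos l with rfl | hl
  · simp at hlog ⊢
    linarith
  have hC : Real.log (k + l).factorial =
      Real.log ((k + l).choose k) + Real.log k.factorial + Real.log l.factorial := by
    rw [← Nat.choose_mul_factorial_mul_factorial (Nat.le_add_right k l), Nat.add_sub_cancel_left]
    have h1 : ((k + l).choose k : ℝ) ≠ 0 := by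
      exact_mod_cast (Nat.choose_pos (Nat.le_add_right k l)).ne'
    push_cast
    rw [Real.log_mul (by positivity) (by positivity), Real.log_mul h1 (by positivity)]
  have hn := Stirling.le_log_factorial_stirling h
  have hk' := log_factorial_le hk.ne'
  have hl' := log_factorial_le hl.ne'
  have hkn : Real.log k ≤ Real.log (k + l : ℕ) :=
    Real.log_le_log (by positivity) (by exact_mod_cast Nat.le_add_right k l)
  have hln : Real.log l ≤ Real.log (k + l : ℕ) :=
    Real.log_le_log (by positivity) (by exact_mod_cast Nat.le_add_left l k)
  have h2pi : 0 ≤ Real.log (2 * Real.pi) := Real.log_nonneg (by linarith [Real.pi_gt_three])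
  push_cast at *
  linarith

lemma mul_log_sub_mul_log_le {x y : ℝ} (hx : 0 ≤ x) (hy : 0 < y) :
    x * Real.log y - x * Real.log x ≤ y - x := by
  rcases hx.eq_or_lt with rfl | hx
  · simpa using hy.le
  have h := Real.log_le_sub_one_of_pos (div_pos hy hx)
  rw [Real.log_div hy.ne' hx.ne'] at h
  have := mul_le_mul_of_nonneg_left h hx.le
  have h2 : x * (y / x - 1) = y - x := by field_simp
  linarith

/-- Shifting mass at most one between two positive parts of a sum changes `t log t + s log s`
by a bounded amount, provided that the smaller part is a positive proportion of the sum. -/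
lemma mul_log_add_mul_log_shift {x y k l r : ℝ} (hx : 0 ≤ x) (hk : x ≤ k) (hk1 : k ≤ x + 1)
    (hk0 : x = 0 → k = 0) (hl : 0 < l) (hsum : x + y = k + l) (hr0 : 0 < r) (hr1 : r ≤ 1)
    (hr : r * (k + l) ≤ l) :
    k * Real.log k + l * Real.log l + Real.log r ≤ x * Real.log x + y * Real.log y := by
  rcases hx.eq_or_lt with rfl | hx
  · obtain rfl := hk0 rfl
    have : y = l := by linarith
    have := Real.log_nonpos hr0.le hr1
    subst y
    simpa using this
  have hkp : 0 < k := hx.trans_le hk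
  have h1 := mul_log_sub_mul_log_le hx.le hkp
  have h2 := mul_log_sub_mul_log_le (x := y) (y := l) (by linarith) hl
  have h3 : Real.log r + Real.log k ≤ Real.log l := by
    rw [← Real.log_mul hr0.ne' hkp.ne']
    exact Real.log_le_log (by positivity) (by nlinarith)
  have hy : y = l + (k - x) := by linarith
  have h4 : (k - x) * Real.log r ≥ Real.log r := by
    nlinarith [Real.log_nonpos hr0.le hr1]
  have h5 := mul_le_mul_of_nonneg_left h3 (sub_nonneg.2 hk)
  rw [hy] at h2 ⊢
  nlinarith

/-- If the expected number of samples contained in a fixed set of size `k < n` is of constant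
order, then the sets of size `k` are minimal with probability of order `p ^ k`. -/
lemma choose_mul_pow_le_expMin {n m k l : ℕ} {p : ℝ} (hp0 : 0 < p) (hp1 : p < 1)
    (hkl : k + l = n) (hl : l ≠ 0) (h1 : 1 - p ≤ m * (1 - p) ^ l)
    (h2 : m * (1 - p) ^ l ≤ 1 / (1 - p)) :
    n.choose k * (p ^ k * ((1 - p) * Real.exp (-(1 / (1 - p) / p)))) ≤ expMin n m p := by
  have hq : 0 < 1 - p := by linarith
  refine le_trans ?_ (le_expMin (k := k) hp0.le hp1.le)
  rw [show n - k = l by omega]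
  set t := (1 - p) ^ l
  have ht0 : 0 < t := by positivity
  have htq : t ≤ 1 - p := pow_le_of_le_one hq.le (by linarith) hl
  have hexp : Real.exp (-(1 / (1 - p) / p)) ≤ (1 - t) ^ (m - 1) := by
    calc Real.exp (-(1 / (1 - p) / p)) ≤ Real.exp (m * -(t / p)) := by
          rw [Real.exp_le_exp, mul_neg, ← mul_div_assoc]
          gcongr
      _ ≤ (1 - t) ^ m := by
          rw [Real.exp_nat_mul]
          gcongr
          rw [← Real.le_log_iff_exp_le (by linarith)]
          have h := Real.one_sub_inv_le_log_of_pos (show 0 < 1 - t by linarith)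
          refine le_trans ?_ h
          have h3 : t / (1 - t) ≤ t / p := by
            gcongr
            linarith
          have h4 : 1 - (1 - t)⁻¹ = -(t / (1 - t)) := by
            have : 1 - t ≠ 0 := by linarith
            field_simp
            ring
          linarith
      _ ≤ (1 - t) ^ (m - 1) :=
          pow_le_pow_of_le_one (by linarith) (by linarith) (Nat.sub_le _ _)
  calc _ ≤ n.choose k * (p ^ k * ((m * t) * (1 - t) ^ (m - 1))) := by gcongr
    _ = _ := by ring

lemma two_rpow_entropy_eq {n : ℕ} (hn : n ≠ 0) {p α : ℝ} (hα : α ≠ 0) :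
    (2 : ℝ) ^ ((binEnt α + (1 - α) * Real.logb 2 p) * n) =
      Real.exp (n * Real.log n - α * n * Real.log (α * n) -
        (1 - α) * n * Real.log ((1 - α) * n) + (1 - α) * n * Real.log p) := by
  have hn' : (n : ℝ) ≠ 0 := by exact_mod_cast hn
  have hβ : (1 - α) * Real.log ((1 - α) * n) =
      (1 - α) * (Real.log (1 - α) + Real.log n) := by
    by_cases h : 1 - α = 0
    · simp [h]
    · rw [Real.log_mul h hn']
  have h2 : Real.log 2 ≠ 0 := by positivity
  rw [Real.rpow_def_of_pos two_pos, Real.log_mul hα hn', mul_right_comm (1 - α) (n : ℝ), hβ]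
  congr 1
  simp only [binEnt, Real.logb]
  field_simp
  ring

/-- **Lower bound in the information-theoretic regime.** For
`1/(1-p)^{(1-p)n} ≤ m ≤ 1/(1-p)^n`, with `α = -(log m)/(n·log(1-p))`,
`E[|min(B_{n,m,p})|] ≥ c · 2^{(Hb(α)+(1-α)·log₂ p)·n} / √n`. -/
theorem info_regime_lower (p : ℝ) (hp0 : 0 < p) (hp1 : p < 1) :
    ∃ c > (0 : ℝ), ∀ n m : ℕ, 0 < n → 0 < m →
      1 / (1 - p) ^ ((1 - p) * n) ≤ (m : ℝ) → (m : ℝ) ≤ 1 / (1 - p) ^ (n : ℝ) →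
      ∀ α : ℝ, α = -(Real.log m) / (n * Real.log (1 - p)) →
      c * (2 : ℝ) ^ ((binEnt α + (1 - α) * Real.logb 2 p) * n) / Real.sqrt n ≤
        expMin n m p := by
  have hq : 0 < 1 - p := by linarith
  have hlq : Real.log (1 - p) < 0 := Real.log_neg hq (by linarith)
  have hlp : Real.log p < 0 := Real.log_neg hp0 hp1
  set A := (1 - p) * Real.exp (-(1 / (1 - p) / p))
  have hA0 : 0 < A := by positivity
  set B := -2 / (1 - p) - 2 + Real.log ((1 - p) / 2) + Real.log p with hB
  have hr : Real.log ((1 - p) / 2) ≤ 0 := Real.log_nonpos (by linarith) (by linarith)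
  refine ⟨Real.exp B * A, by positivity, fun n m hn hm hlow hupp α hα => ?_⟩
  have hn' : (0 : ℝ) < n := by exact_mod_cast hn
  have hm' : (0 : ℝ) < m := by exact_mod_cast hm
  have hlogm : Real.log m = -(α * n * Real.log (1 - p)) := by
    have := hlq.ne
    rw [hα]
    field_simp
  have hα1 : α ≤ 1 := by
    have h := Real.log_le_log hm' hupp
    rw [one_div, Real.log_inv, Real.log_rpow hq, hlogm] at h
    by_contra! hc
    nlinarith [mul_pos (sub_pos.2 hc) (mul_pos hn' (neg_pos.2 hlq))]
  have hαq : 1 - p ≤ α := by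
    have h := Real.log_le_log (by positivity) hlow
    rw [one_div, Real.log_inv, Real.log_rpow hq, hlogm] at h
    by_contra! hc
    nlinarith [mul_pos (sub_pos.2 hc) (mul_pos hn' (neg_pos.2 hlq))]
  have hα0 : 0 < α := hq.trans_le hαq
  -- It suffices to find a size with the right entropy.
  suffices H : ∃ k l : ℕ, k + l = n ∧ l ≠ 0 ∧ |l - α * n| ≤ 1 ∧
      B + (n * Real.log n - α * n * Real.log (α * n) -
        (1 - α) * n * Real.log ((1 - α) * n) + (1 - α) * n * Real.log p) - Real.log n / 2 ≤
      Real.log (n.choose k) + k * Real.log p by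
    obtain ⟨k, l, hkl, hl, habs, hlog⟩ := H
    have hmq : m * (1 - p) ^ l = Real.exp ((l - α * n) * Real.log (1 - p)) := by
      rw [← Real.exp_log (show 0 < m * (1 - p) ^ l by positivity),
        Real.log_mul hm'.ne' (by positivity), Real.log_pow, hlogm]
      congr 1
      ring
    rw [abs_le] at habs
    refine le_trans ?_ (choose_mul_pow_le_expMin hp0 hp1 hkl hl ?_ ?_)
    · have hC : (0 : ℝ) < n.choose k := by exact_mod_cast Nat.choose_pos (by omega)
      have h := Real.exp_le_exp.2 hlog
      rw [Real.exp_add, Real.exp_log hC, Real.exp_nat_mul, Real.exp_log hp0,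
        Real.exp_sub, Real.exp_add B, Real.exp_half, Real.exp_log hn'] at h
      rw [two_rpow_entropy_eq hn.ne' hα0.ne']
      calc _ = Real.exp B * Real.exp (n * Real.log n - α * n * Real.log (α * n) -
            (1 - α) * n * Real.log ((1 - α) * n) + (1 - α) * n * Real.log p) / √n * A := by ring
        _ ≤ n.choose k * p ^ k * A := by gcongr
        _ = _ := by ring
    · rw [hmq, ← Real.log_le_iff_le_exp hq]
      nlinarith
    · rw [hmq, one_div, ← Real.exp_log hq, ← Real.exp_neg, Real.exp_le_exp, Real.log_exp]
      nlinarith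
  have hsum : (1 - α) * n + α * n = n := by ring
  have hβ0 : 0 ≤ (1 - α) * n := mul_nonneg (by linarith) hn'.le
  by_cases hsmall : α * n < 1
  · refine ⟨n - 1, 1, by omega, one_ne_zero, ?_, ?_⟩
    · rw [abs_le]
      constructor <;> push_cast <;> nlinarith
    · have hnq : n ≤ 1 / (1 - p) := by
        rw [le_div_iff₀ hq]
        nlinarith
      have h1 := mul_log_sub_mul_log_le (x := α * n) (y := n) (by positivity) hn'
      have h2 := mul_log_sub_mul_log_le (x := (1 - α) * n) (y := n) hβ0 hn'
      have h3 : 0 ≤ Real.log (n.choose (n - 1)) := Real.log_natCast_nonneg _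
      have h4 : 0 ≤ Real.log n := Real.log_natCast_nonneg _
      have h5 : (1 - α) * n * Real.log p ≤ ((n - 1 : ℕ) : ℝ) * Real.log p := by
        refine mul_le_mul_of_nonpos_right ?_ hlp.le
        rw [Nat.cast_sub hn]
        push_cast
        linarith
      have h6 : n * Real.log n = α * n * Real.log n + (1 - α) * n * Real.log n := by ring
      have h7 : -2 / (1 - p) = -(2 * (1 / (1 - p))) := by ring
      linarith
  · push Not at hsmall
    set l := ⌊α * n⌋₊ with hl
    have hl1 : 1 ≤ l := Nat.le_floor (by simpa using hsmall)
    have hly : (l : ℝ) ≤ α * n := Nat.floor_le (by positivity)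
    have hly' : α * n < l + 1 := Nat.lt_floor_add_one _
    have hln : l ≤ n := by
      have : (l : ℝ) ≤ n := by nlinarith
      exact_mod_cast this
    obtain ⟨k, hk⟩ := Nat.exists_eq_add_of_le' hln
    have hkR : (n : ℝ) = k + l := by exact_mod_cast hk
    have hl1' : (1 : ℝ) ≤ l := by exact_mod_cast hl1
    refine ⟨k, l, hk.symm, by omega, by rw [abs_le]; constructor <;> linarith, ?_⟩
    have h1 := le_log_choose_add k l (by omega)
    rw [← hk] at h1
    have h2 := mul_log_add_mul_log_shift (x := (1 - α) * n) (y := α * n) (k := k) (l := l)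
      (r := (1 - p) / 2) hβ0 (by linarith) (by linarith) ?_ (by linarith) (by linarith)
      (by linarith) (by linarith) (by rw [← hkR]; nlinarith)
    · have h3 : ((1 - α) * n + 1) * Real.log p ≤ k * Real.log p :=
        mul_le_mul_of_nonpos_right (by linarith) hlp.le
      have h4 : -2 / (1 - p) ≤ 0 := div_nonpos_of_nonpos_of_nonneg (by norm_num) hq.le
      linarith
    · intro h0
      have : α * n = n := by linarith
      rw [this, Nat.floor_natCast] at hl
      have : (l : ℝ) = n := by exact_mod_cast hl
      linarith
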